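/- For |q|<1, Σ_{n∈ℤ} (-1)^n q^{3n²+3n}/(1+q^{3n+1})² + Σ_{n∈ℤ} (-1)^n q^{3n²+3n}/(1-q^{3n+1})² = (4/3)·J₆³/J₂ + J_{3,6}² J₆⁶/(2 J_{1,6}² J₂²) + J_{1,6}⁶ J₂² J_{3,6}²/(6 J₆⁶). -/

import Mathlib

open scoped BigOperators

noncomputable def poch (a q : ℂ) : ℂ := ∏' n : ℕ, (1 - a * q ^ n)

noncomputable def Jm (m : ℕ) (q : ℂ) : ℂ := poch (q ^ m) (q ^ m)

noncomputable def Jam (a m : ℕ) (q : ℂ) : ℂ :=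
  poch (q ^ a) (q ^ m) * poch (q ^ (m - a)) (q ^ m) * poch (q ^ m) (q ^ m)

noncomputable def Sser (a Q : ℂ) : ℂ :=
  ∑' n : ℕ, (1 / (1 - a * Q ^ n) - 1 / (1 - a⁻¹ * Q ^ (n + 1)))

section

open Filter Topology Finset

theorem prod_eq_one_add_sum_partialFraction {K : Type*} [Field K] {x y : ℕ → K} {C : ℕ → ℕ → K}
    (hy0 : ∀ k, y k ≠ 0) (hinj : ∀ j k, j < k → y j ≠ y k)
    (hC : ∀ N k, k < N → C (N + 1) k = C N k * ((y k + x N) / (y k - y N)))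
    (hC' : ∀ N, C (N + 1) N =
      -(x N + y N) * ∏ j ∈ range N, (y N + x j) / (y N - y j)) (N : ℕ) :
    ∀ t : K, (∀ k < N, 1 + y k * t ≠ 0) →
      ∏ k ∈ range N, (1 - x k * t) / (1 + y k * t) =
        1 + ∑ k ∈ range N, C N k * (t / (1 + y k * t)) := by
  induction N with
  | zero => simp
  | succ N ih =>
    intro t ht
    have hs : ∀ k < N, y N - y k ≠ 0 := fun k hk => sub_ne_zero.2 (hinj k N hk).symm
    have hN := hy0 N
    have hpole := ih (-(y N)⁻¹) fun k hk => by
      have := hs k hk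
      have e : 1 + y k * -(y N)⁻¹ = (y N - y k) / y N := by field_simp; ring
      rw [e]; exact div_ne_zero this hN
    have hprod : ∏ k ∈ range N, (1 - x k * -(y N)⁻¹) / (1 + y k * -(y N)⁻¹) =
        ∏ j ∈ range N, (y N + x j) / (y N - y j) := prod_congr rfl fun k hk => by
      have := hs k (mem_range.1 hk)
      have e : 1 + y k * -(y N)⁻¹ = (y N - y k) / y N := by field_simp; ring
      rw [e]; field_simp; ring
    rw [hprod] at hpole
    have htN : 1 + y N * t ≠ 0 := ht N (by simp)
    rw [prod_range_succ, ih t fun k hk => ht k (by lia), sum_range_succ, hC', hpole,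
      mul_add (-(x N + y N)), add_mul, mul_sum, sum_mul, add_mul, sum_mul]
    have e : ∀ k ∈ range N, C N k * (t / (1 + y k * t)) * ((1 - x N * t) / (1 + y N * t)) =
        C (N + 1) k * (t / (1 + y k * t)) + -(x N + y N) *
          (C N k * (-(y N)⁻¹ / (1 + y k * -(y N)⁻¹))) * (t / (1 + y N * t)) := by
      intro k hk
      have hk := mem_range.1 hk
      have h1 := hs k hk
      have h2 := ht k (by lia)
      have h3 : y k - y N ≠ 0 := by rw [← neg_sub]; exact neg_ne_zero.2 h1
      rw [hC N k hk]
      have e : 1 + y k * -(y N)⁻¹ = (y N - y k) / y N := by field_simp; ring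
      have e2 : y k - y N = - (y N - y k) := by ring
      rw [e, e2]
      obtain ⟨A, hA⟩ : ∃ A, A = 1 + y k * t := ⟨_, rfl⟩
      obtain ⟨B, hB⟩ : ∃ B, B = 1 + y N * t := ⟨_, rfl⟩
      rw [← hA] at h2 ⊢
      rw [← hB] at htN ⊢
      field_simp
      rw [hA, hB]
      ring
    rw [sum_congr rfl e, sum_add_distrib]
    have h1 := div_self htN
    linear_combination h1

theorem tendsto_sum_mul_of_bounded {W : ℕ → ℕ → ℂ} {c : ℕ → ℂ} {M : ℝ} (hc : Summable c)
    (hM : ∀ N, ∀ k < N, ‖W N k‖ ≤ M) (hW : ∀ k, Tendsto (W · k) atTop (𝓝 1)) :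
    Tendsto (fun N => ∑ k ∈ range N, c k * W N k) atTop (𝓝 (∑' k, c k)) := by
  have key := tendsto_tsum_of_dominated_convergence (𝓕 := atTop)
    (f := fun N k => if k < N then c k * W N k else 0) (g := c)
    (bound := fun k => ‖c k‖ * M) (hc.norm.mul_right M) ?_ ?_
  · refine key.congr fun N => ?_
    rw [tsum_eq_sum (s := range N)]
    · exact sum_congr rfl fun k hk => by simp [mem_range.1 hk]
    · intro k hk
      simp at hk
      simp [hk]
  · intro k
    have : Tendsto (fun N => c k * W N k) atTop (𝓝 (c k * 1)) := (hW k).const_mul _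
    rw [mul_one] at this
    refine this.congr' ?_
    filter_upwards [eventually_gt_atTop k] with N hN
    simp [hN]
  · refine Eventually.of_forall fun N k => ?_
    split_ifs with h
    · rw [norm_mul]; gcongr; exact hM N k h
    · have := (norm_nonneg _).trans (hM (k + 1) k (by lia))
      simp; positivity

/-- The ratio `G (N - k) * G (N + k) / G N ^ 2`, with `k` replaced by `k + 1`. -/
noncomputable def centralRatio (G : ℕ → ℂ) (N k : ℕ) : ℂ :=
  G (N - 1 - k) * G (N + k + 1) / G N ^ 2

theorem tendsto_centralRatio {G : ℕ → ℂ} {l : ℂ} (hl : l ≠ 0) (hG : Tendsto G atTop (𝓝 l)) (k : ℕ) :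
    Tendsto (centralRatio G · k) atTop (𝓝 1) := by
  have h1 : Tendsto (fun N => N - 1 - k) atTop atTop := by
    simp_rw [Nat.sub_sub]; exact tendsto_sub_atTop_nat _
  have h2 : Tendsto (fun N => N + k + 1) atTop atTop := by
    simp_rw [add_assoc]; exact tendsto_add_atTop_nat _
  have := ((hG.comp h1).mul (hG.comp h2)).div (hG.pow 2) (pow_ne_zero 2 hl)
  rwa [← sq, div_self (pow_ne_zero 2 hl)] at this

theorem exists_norm_le_of_tendsto {G : ℕ → ℂ} {l : ℂ} (hG : Tendsto G atTop (𝓝 l)) :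
    ∃ M, ∀ n, ‖G n‖ ≤ M := by
  obtain ⟨M, hM⟩ := hG.norm.bddAbove_range
  exact ⟨M, fun n => hM ⟨n, rfl⟩⟩

theorem exists_norm_centralRatio_le {G : ℕ → ℂ} {l : ℂ} (hl : l ≠ 0)
    (hG : Tendsto G atTop (𝓝 l)) : ∃ M, ∀ N k, ‖centralRatio G N k‖ ≤ M := by
  obtain ⟨A, hA⟩ := exists_norm_le_of_tendsto hG
  obtain ⟨B, hB⟩ := exists_norm_le_of_tendsto ((hG.pow 2).inv₀ (pow_ne_zero 2 hl))
  refine ⟨A * A * B, fun N k => ?_⟩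
  have hA0 := (norm_nonneg _).trans (hA 0)
  rw [centralRatio, div_eq_mul_inv, norm_mul, norm_mul]
  gcongr
  exacts [hA _, hA _, hB _]

theorem mul_centralRatio_succ {g : ℕ → ℂ} (hg : ∀ n, g (n + 1) ≠ 0) {N k : ℕ} (hk : k < N) :
    centralRatio (fun n => ∏ i ∈ range n, g (i + 1)) (N + 1) k =
      centralRatio (fun n => ∏ i ∈ range n, g (i + 1)) N k *
        (g (N - k) * g (N + k + 2) / g (N + 1) ^ 2) := by
  obtain ⟨m, rfl⟩ : ∃ m, N = m + 1 + k := ⟨N - 1 - k, by lia⟩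
  have h0 : ∏ i ∈ range (m + 1 + k), g (i + 1) ≠ 0 := prod_ne_zero_iff.2 fun i _ => hg i
  have h1 := hg (m + 1 + k)
  have e1 : m + 1 + k + 1 - 1 - k = m + 1 := by lia
  have e2 : m + 1 + k - 1 - k = m := by lia
  have e3 : m + 1 + k - k = m + 1 := by lia
  have e4 : m + 1 + k + 1 + k + 1 = m + 1 + k + k + 1 + 1 := by lia
  simp only [centralRatio]
  rw [e1, e2, e3, e4, prod_range_succ _ m, prod_range_succ _ (m + 1 + k + k + 1),
    prod_range_succ _ (m + 1 + k)]
  field_simp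

theorem prod_range_sub_mul_add {g : ℕ → ℂ} (hg : ∀ n, g (n + 1) ≠ 0) (N : ℕ) :
    ∏ j ∈ range N, g (N - j) * g (N + j + 2) / g (j + 1) ^ 2 =
      g (N + 1) / g (2 * N + 2) *
        centralRatio (fun n => ∏ i ∈ range n, g (i + 1)) (N + 1) N := by
  have hP : ∀ n, ∏ i ∈ range n, g (i + 1) ≠ 0 := fun n => prod_ne_zero_iff.2 fun i _ => hg i
  have h1 : ∏ j ∈ range N, g (N - j) = ∏ j ∈ range N, g (j + 1) := by
    rw [← prod_range_reflect]
    refine prod_congr rfl fun j hj => ?_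
    have := mem_range.1 hj
    congr 1; lia
  have h2 : ∏ j ∈ range (2 * N + 2), g (j + 1) =
      (∏ j ∈ range (N + 1), g (j + 1)) * (∏ j ∈ range N, g (N + j + 2)) * g (2 * N + 2) := by
    rw [show 2 * N + 2 = N + 1 + (N + 1) by lia, prod_range_add, prod_range_succ _ N,
      prod_range_succ _ N, mul_assoc]
    simp only [mul_assoc]
    congr 3
    · exact prod_congr rfl fun j _ => by congr 1; lia
  simp only [centralRatio]
  rw [prod_div_distrib, prod_mul_distrib, h1, prod_pow,
    show N + 1 + N + 1 = 2 * N + 2 by lia, h2, show N + 1 - 1 - N = 0 by lia,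
    prod_range_succ _ N]
  have := hP N
  have := hg N
  have := hg (2 * N + 1)
  simp only [range_zero, prod_empty]
  field_simp

theorem prod_eq_one_add_sum_centralRatio {g σ x y : ℕ → ℂ} (hg : ∀ n, g (n + 1) ≠ 0)
    (hy0 : ∀ k, y k ≠ 0) (hinj : ∀ j k, j < k → y j ≠ y k)
    (h1 : ∀ N k, k < N → (y k + x N) / (y k - y N) = g (N - k) * g (N + k + 2) / g (N + 1) ^ 2)
    (h2 : ∀ N j, j < N → (y N + x j) / (y N - y j) =
      σ (N - j) * (g (N - j) * g (N + j + 2) / g (j + 1) ^ 2))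
    (N : ℕ) (t : ℂ) (ht : ∀ k < N, 1 + y k * t ≠ 0) :
    ∏ k ∈ range N, (1 - x k * t) / (1 + y k * t) =
      1 + ∑ k ∈ range N, (-(x k + y k) * (∏ i ∈ range k, σ (i + 1)) *
        (g (k + 1) / g (2 * k + 2)) * centralRatio (fun n => ∏ i ∈ range n, g (i + 1)) N k) *
          (t / (1 + y k * t)) := by
  refine prod_eq_one_add_sum_partialFraction (C := fun N k => -(x k + y k) *
    (∏ i ∈ range k, σ (i + 1)) * (g (k + 1) / g (2 * k + 2)) *
      centralRatio (fun n => ∏ i ∈ range n, g (i + 1)) N k) hy0 hinj ?_ ?_ N t ht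
  · intro N k hk
    rw [mul_centralRatio_succ hg hk, h1 N k hk]
    ring
  · intro N
    have e : ∏ i ∈ range N, σ (N - i) = ∏ i ∈ range N, σ (i + 1) := by
      rw [← prod_range_reflect]
      refine prod_congr rfl fun j hj => ?_
      have := mem_range.1 hj
      congr 1; lia
    rw [prod_congr rfl fun j hj => h2 N j (mem_range.1 hj), prod_mul_distrib,
      prod_range_sub_mul_add hg, e]
    ring

theorem one_sub_ne_zero_of_norm_lt {z : ℂ} (hz : ‖z‖ < 1) : 1 - z ≠ 0 := by
  intro h
  rw [← sub_eq_zero.1 h] at hz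
  simp at hz

theorem one_add_ne_zero_of_norm_lt {z : ℂ} (hz : ‖z‖ < 1) : 1 + z ≠ 0 := by
  have := one_sub_ne_zero_of_norm_lt (z := -z) (by simpa)
  simpa using this

theorem norm_pow_succ_lt_one {Q : ℂ} (hQ : ‖Q‖ < 1) (n : ℕ) : ‖Q ^ (n + 1)‖ < 1 := by
  rw [norm_pow]; exact pow_lt_one₀ (norm_nonneg _) hQ (by lia)

theorem tendsto_poch {Q : ℂ} (hQ : ‖Q‖ < 1) (a : ℂ) :
    Tendsto (fun N => ∏ k ∈ range N, (1 - a * Q ^ k)) atTop (𝓝 (poch a Q)) := by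
  have : Multipliable fun k : ℕ => 1 + -(a * Q ^ k) := by
    apply multipliable_one_add_of_summable
    simp only [norm_neg, norm_mul, norm_pow]
    exact (summable_geometric_of_lt_one (norm_nonneg _) hQ).mul_left _
  simpa [poch, sub_eq_add_neg] using this.tendsto_prod_tprod_nat

theorem poch_ne_zero {Q : ℂ} (hQ : ‖Q‖ < 1) {a : ℂ} (ha : ∀ k, 1 - a * Q ^ k ≠ 0) :
    poch a Q ≠ 0 := by
  have : ∏' k : ℕ, (1 + -(a * Q ^ k)) ≠ 0 := by
    apply tprod_one_add_ne_zero_of_summable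
    · simpa [sub_eq_add_neg] using ha
    · simp only [norm_neg, norm_mul, norm_pow]
      exact (summable_geometric_of_lt_one (norm_nonneg _) hQ).mul_left _
  simpa [poch, sub_eq_add_neg] using this

theorem poch_ne_zero_of_norm_lt {Q a : ℂ} (hQ : ‖Q‖ < 1) (ha : ‖a‖ < 1) : poch a Q ≠ 0 := by
  refine poch_ne_zero hQ fun k => one_sub_ne_zero_of_norm_lt ?_
  rw [norm_mul, norm_pow]
  exact (mul_le_of_le_one_right (norm_nonneg _) (pow_le_one₀ (norm_nonneg _) hQ.le)).trans_lt ha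

/-- The opposites of the inverse poles `Q ^ (k + 1) / (1 - Q ^ (k + 1)) ^ 2`. -/
noncomputable def poleParam (Q : ℂ) (k : ℕ) : ℂ := Q ^ (k + 1) / (1 - Q ^ (k + 1)) ^ 2

variable {Q : ℂ}

theorem poleParam_ne_zero (hQ0 : Q ≠ 0) (hQ : ‖Q‖ < 1) (k : ℕ) : poleParam Q k ≠ 0 :=
  div_ne_zero (pow_ne_zero _ hQ0)
    (pow_ne_zero _ (one_sub_ne_zero_of_norm_lt (norm_pow_succ_lt_one hQ k)))

theorem summable_poleParam (hQ : ‖Q‖ < 1) : Summable (poleParam Q) := by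
  have h : Tendsto (fun k : ℕ => ((1 - Q ^ (k + 1)) ^ 2)⁻¹) atTop (𝓝 ((1 - 0) ^ 2)⁻¹) :=
    (((((tendsto_pow_atTop_nhds_zero_of_norm_lt_one hQ).comp
      (tendsto_add_atTop_nat 1)).const_sub 1).pow 2).inv₀ (by norm_num))
  obtain ⟨M, hM⟩ := exists_norm_le_of_tendsto h
  refine Summable.of_norm_bounded (g := fun k => ‖Q‖ ^ (k + 1) * M)
    (((summable_geometric_of_lt_one (norm_nonneg _) hQ).comp_injective
      (add_left_injective 1)).mul_right M) fun k => ?_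
  rw [poleParam, div_eq_mul_inv, norm_mul, norm_pow]
  gcongr
  exact hM k

theorem poleParam_sub (hQ : ‖Q‖ < 1) (j m : ℕ) : poleParam Q j - poleParam Q (j + m + 1) =
    Q ^ (j + 1) * (1 - Q ^ (m + 1)) * (1 - Q ^ (j + j + m + 3)) /
      ((1 - Q ^ (j + 1)) ^ 2 * (1 - Q ^ (j + m + 2)) ^ 2) := by
  have h1 := one_sub_ne_zero_of_norm_lt (norm_pow_succ_lt_one hQ j)
  have h2 := one_sub_ne_zero_of_norm_lt (norm_pow_succ_lt_one hQ (j + m + 1))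
  rw [poleParam, poleParam, div_sub_div _ _ (pow_ne_zero 2 h1) (pow_ne_zero 2 h2)]
  congr 1
  ring

theorem poleParam_injective (hQ0 : Q ≠ 0) (hQ : ‖Q‖ < 1) (j k : ℕ) (hjk : j < k) :
    poleParam Q j ≠ poleParam Q k := by
  obtain ⟨m, rfl⟩ := Nat.exists_eq_add_of_lt hjk
  have h := fun n => one_sub_ne_zero_of_norm_lt (norm_pow_succ_lt_one hQ n)
  rw [← sub_ne_zero, poleParam_sub hQ]
  exact div_ne_zero (mul_ne_zero (mul_ne_zero (pow_ne_zero _ hQ0) (h _)) (h (j + j + m + 2)))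
    (mul_ne_zero (pow_ne_zero 2 (h _)) (pow_ne_zero 2 (h (j + m + 1))))

theorem exists_norm_inv_one_add_mul_le {y : ℕ → ℂ} (hy : Tendsto y atTop (𝓝 0)) (t : ℂ) :
    ∃ M, ∀ k, ‖(1 + y k * t)⁻¹‖ ≤ M := by
  have h : Tendsto (fun k => (1 + y k * t)⁻¹) atTop (𝓝 (1 + 0 * t)⁻¹) :=
    ((hy.mul_const t).const_add 1).inv₀ (by simp)
  exact exists_norm_le_of_tendsto h

theorem summable_mul_of_bounded {ι : Type*} {f b : ι → ℂ} {M : ℝ} (hf : Summable f)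
    (hb : ∀ k, ‖b k‖ ≤ M) : Summable fun k => f k * b k := by
  refine Summable.of_norm_bounded (hf.norm.mul_right M) fun k => ?_
  rw [norm_mul]; gcongr; exact hb k

theorem summable_mul_div_one_add {c y : ℕ → ℂ} (hc : Summable c) (hy : Tendsto y atTop (𝓝 0))
    (t : ℂ) : Summable fun k => c k * (t / (1 + y k * t)) := by
  obtain ⟨M, hM⟩ := exists_norm_inv_one_add_mul_le hy t
  have := (summable_mul_of_bounded hc hM).mul_left t
  refine this.congr fun k => by ring

/-- The partial fraction expansion of `∏ (1 - x_k t) / (1 + y_k t)`, where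
`x_k = Q ^ (k + 1) / (1 + Q ^ (k + 1)) ^ 2` and `y_k = Q ^ (k + 1) / (1 - Q ^ (k + 1)) ^ 2`. -/
theorem theta_quotient_eq_one_add_tsum (hQ0 : Q ≠ 0) (hQ : ‖Q‖ < 1) {t P : ℂ}
    (ht : ∀ k, 1 + poleParam Q k * t ≠ 0)
    (hP : Tendsto (fun N => ∏ k ∈ range N, (1 - Q ^ (k + 1) / (1 + Q ^ (k + 1)) ^ 2 * t) /
      (1 + poleParam Q k * t)) atTop (𝓝 P)) :
    P = 1 + ∑' k, 2 * (-1) ^ (k + 1) * poleParam Q k * (t / (1 + poleParam Q k * t)) := by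
  have hs := fun n => one_sub_ne_zero_of_norm_lt (norm_pow_succ_lt_one hQ n)
  have ha := fun n => one_add_ne_zero_of_norm_lt (norm_pow_succ_lt_one hQ n)
  set g : ℕ → ℂ := fun n => (1 + Q ^ n) / (1 - Q ^ n) with hgdef
  have hg : ∀ n, g (n + 1) ≠ 0 := fun n => div_ne_zero (ha n) (hs n)
  have hG : Tendsto (fun n => ∏ i ∈ range n, g (i + 1)) atTop
      (𝓝 (poch (-Q) Q / poch Q Q)) := by
    refine ((tendsto_poch hQ (-Q)).div (tendsto_poch hQ Q)
      (poch_ne_zero_of_norm_lt hQ hQ)).congr fun n => ?_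
    simp only [Pi.div_apply]
    rw [← prod_div_distrib]
    refine prod_congr rfl fun i _ => ?_
    simp only [hgdef]; ring
  have hl : poch (-Q) Q / poch Q Q ≠ 0 :=
    div_ne_zero (poch_ne_zero_of_norm_lt hQ (by simpa)) (poch_ne_zero_of_norm_lt hQ hQ)
  have hyx : ∀ j m : ℕ, poleParam Q j + Q ^ (j + m + 1 + 1) / (1 + Q ^ (j + m + 1 + 1)) ^ 2 =
      Q ^ (j + 1) * (1 + Q ^ (m + 1)) * (1 + Q ^ (j + j + m + 3)) /
      ((1 - Q ^ (j + 1)) ^ 2 * (1 + Q ^ (j + m + 2)) ^ 2) := fun j m => by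
    rw [poleParam, div_add_div _ _ (pow_ne_zero 2 (hs j)) (pow_ne_zero 2 (ha (j + m + 1)))]
    congr 1
    ring
  have hxy : ∀ j m : ℕ, poleParam Q (j + m + 1) + Q ^ (j + 1) / (1 + Q ^ (j + 1)) ^ 2 =
      Q ^ (j + 1) * (1 + Q ^ (m + 1)) * (1 + Q ^ (j + j + m + 3)) /
      ((1 - Q ^ (j + m + 2)) ^ 2 * (1 + Q ^ (j + 1)) ^ 2) := fun j m => by
    rw [poleParam, div_add_div _ _ (pow_ne_zero 2 (hs (j + m + 1))) (pow_ne_zero 2 (ha j))]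
    congr 1
    ring
  have key := fun N => prod_eq_one_add_sum_centralRatio (g := g) (σ := fun _ => -1)
    (x := fun k => Q ^ (k + 1) / (1 + Q ^ (k + 1)) ^ 2) (y := poleParam Q) hg
    (poleParam_ne_zero hQ0 hQ) (poleParam_injective hQ0 hQ) (by
      intro N k hk
      obtain ⟨m, rfl⟩ := Nat.exists_eq_add_of_lt hk
      rw [poleParam_sub hQ, hyx, show k + m + 1 - k = m + 1 by lia,
        show k + m + 1 + k + 2 = k + k + m + 2 + 1 by lia]
      have h1 := hs m
      have h2 := hs (k + k + m + 2)
      have h3 := hs k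
      have h4 := hs (k + m + 1)
      have h5 := ha (k + m + 1)
      have h6 := pow_ne_zero (k + 1) hQ0
      simp only [hgdef, add_assoc, Nat.reduceAdd] at *
      field_simp) (by
      intro N k hk
      obtain ⟨m, rfl⟩ := Nat.exists_eq_add_of_lt hk
      rw [← neg_sub (poleParam Q k), poleParam_sub hQ, hxy, show k + m + 1 - k = m + 1 by lia,
        show k + m + 1 + k + 2 = k + k + m + 2 + 1 by lia]
      have h1 := hs m
      have h2 := hs (k + k + m + 2)
      have h3 := hs k
      have h4 := hs (k + m + 1)
      have h5 := ha k
      have h6 := pow_ne_zero (k + 1) hQ0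
      simp only [hgdef, add_assoc, Nat.reduceAdd] at *
      field_simp) N t fun k _ => ht k
  have hE : ∀ k, -(Q ^ (k + 1) / (1 + Q ^ (k + 1)) ^ 2 + poleParam Q k) *
      (∏ i ∈ range k, (-1 : ℂ)) * (g (k + 1) / g (2 * k + 2)) =
        2 * (-1) ^ (k + 1) * poleParam Q k := fun k => by
    have h1 := hs k
    have h2 := ha k
    have h3 : 1 - (Q ^ (k + 1)) ^ 2 ≠ 0 := by
      have := hs (2 * k + 1)
      rwa [← pow_mul, show (k + 1) * 2 = 2 * k + 1 + 1 by lia]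
    have h4 : 1 + (Q ^ (k + 1)) ^ 2 ≠ 0 := by
      have := ha (2 * k + 1)
      rwa [← pow_mul, show (k + 1) * 2 = 2 * k + 1 + 1 by lia]
    simp only [hgdef, poleParam, prod_const, card_range]
    rw [show Q ^ (2 * k + 2) = (Q ^ (k + 1)) ^ 2 by ring]
    generalize Q ^ (k + 1) = v at *
    field_simp
    ring
  obtain ⟨M, hM⟩ := exists_norm_centralRatio_le hl hG
  have hsum : Summable fun k => 2 * (-1) ^ (k + 1) * poleParam Q k := by
    refine Summable.of_norm_bounded ((summable_poleParam hQ).norm.mul_left 2) fun k => ?_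
    simp
  have lim := (tendsto_sum_mul_of_bounded
    (summable_mul_div_one_add hsum (summable_poleParam hQ).tendsto_atTop_zero t)
    (fun N k _ => hM N k) (tendsto_centralRatio hl hG)).const_add 1
  refine tendsto_nhds_unique hP (lim.congr fun N => ?_)
  rw [key]
  congr 1
  refine sum_congr rfl fun k _ => ?_
  rw [hE]
  ring

theorem hasDerivAt_prod_inv_one_add {y : ℕ → ℂ} {t : ℂ} (ht : ∀ k, 1 + y k * t ≠ 0) (N : ℕ) :
    HasDerivAt (fun t => ∏ k ∈ range N, (1 - 0 * t) / (1 + y k * t))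
      (-(∏ k ∈ range N, (1 - 0 * t) / (1 + y k * t)) * ∑ k ∈ range N, y k / (1 + y k * t)) t := by
  induction N with
  | zero => simpa using hasDerivAt_const t (1 : ℂ)
  | succ N ih =>
    have h1 : HasDerivAt (fun t => 1 + y N * t) (y N) t := by
      simpa using ((hasDerivAt_id t).const_mul (y N)).const_add 1
    have h2 := ih.mul (h1.inv (ht N))
    have e : (fun t => ∏ k ∈ range (N + 1), (1 - 0 * t) / (1 + y k * t)) =
        (fun t => ∏ k ∈ range N, (1 - 0 * t) / (1 + y k * t)) * (fun t => 1 + y N * t)⁻¹ := by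
      funext t
      simp [prod_range_succ, mul_comm]
    rw [e]
    refine h2.congr_deriv ?_
    simp only [Pi.inv_apply]
    rw [prod_range_succ, sum_range_succ]
    have := ht N
    generalize ∏ k ∈ range N, (1 - 0 * t) / (1 + y k * t) = A
    generalize ∑ k ∈ range N, y k / (1 + y k * t) = B
    obtain ⟨C, hC⟩ : ∃ C, C = 1 + y N * t := ⟨_, rfl⟩
    rw [← hC] at this ⊢
    field_simp
    ring

theorem hasDerivAt_one_add_sum_div {c y : ℕ → ℂ} {t : ℂ} (ht : ∀ k, 1 + y k * t ≠ 0) (N : ℕ) :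
    HasDerivAt (fun t => 1 + ∑ k ∈ range N, c k * (t / (1 + y k * t)))
      (∑ k ∈ range N, c k * (1 / (1 + y k * t) ^ 2)) t := by
  refine HasDerivAt.const_add 1 (HasDerivAt.fun_sum fun k _ => HasDerivAt.const_mul (c k) ?_)
  have h1 : HasDerivAt (fun t => 1 + y k * t) (y k) t := by
    simpa using ((hasDerivAt_id t).const_mul (y k)).const_add 1
  refine ((hasDerivAt_id t).div h1 (ht k)).congr_deriv ?_
  simp only [id]
  congr 1
  ring

theorem mul_one_add_two_tsum_eq (hQ0 : Q ≠ 0) (hQ : ‖Q‖ < 1) {t P : ℂ}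
    (ht : ∀ k, 1 + poleParam Q k * t ≠ 0)
    (hP : Tendsto (fun N => ∏ k ∈ range N, (1 + poleParam Q k * t)⁻¹) atTop (𝓝 P)) :
    P * (1 + 2 * ∑' k, poleParam Q k * (t / (1 + poleParam Q k * t))) =
      1 + ∑' k, (-1) ^ (k + 1) * (∏ i ∈ range (k + 1), Q ^ i) * Q ^ (k + 1) *
        (1 + Q ^ (k + 1)) / (1 - Q ^ (k + 1)) ^ 2 *
          (t / (1 + poleParam Q k * t) - 2 * t / (1 + poleParam Q k * t) ^ 2) := by
  have hs := fun n => one_sub_ne_zero_of_norm_lt (norm_pow_succ_lt_one hQ n)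
  have ha := fun n => one_add_ne_zero_of_norm_lt (norm_pow_succ_lt_one hQ n)
  set g : ℕ → ℂ := fun n => (1 - Q ^ n)⁻¹ with hgdef
  have hg : ∀ n, g (n + 1) ≠ 0 := fun n => inv_ne_zero (hs n)
  have hl : (poch Q Q)⁻¹ ≠ 0 := inv_ne_zero (poch_ne_zero_of_norm_lt hQ hQ)
  have hG : Tendsto (fun n => ∏ i ∈ range n, g (i + 1)) atTop (𝓝 (poch Q Q)⁻¹) := by
    refine ((tendsto_poch hQ Q).inv₀ (poch_ne_zero_of_norm_lt hQ hQ)).congr fun n => ?_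
    rw [← prod_inv_distrib]
    refine prod_congr rfl fun i _ => ?_
    simp only [hgdef]; ring
  have key := prod_eq_one_add_sum_centralRatio (g := g) (σ := fun i => -Q ^ i)
    (x := fun _ => 0) (y := poleParam Q) hg
    (poleParam_ne_zero hQ0 hQ) (poleParam_injective hQ0 hQ) (by
      intro N k hk
      obtain ⟨m, rfl⟩ := Nat.exists_eq_add_of_lt hk
      rw [poleParam_sub hQ, show k + m + 1 - k = m + 1 by lia,
        show k + m + 1 + k + 2 = k + k + m + 2 + 1 by lia, poleParam]
      have h1 := hs m
      have h2 := hs (k + k + m + 2)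
      have h3 := hs k
      have h4 := hs (k + m + 1)
      have h6 := pow_ne_zero (k + 1) hQ0
      simp only [hgdef, add_assoc, Nat.reduceAdd, add_zero] at *
      field_simp) (by
      intro N k hk
      obtain ⟨m, rfl⟩ := Nat.exists_eq_add_of_lt hk
      rw [← neg_sub (poleParam Q k), poleParam_sub hQ, show k + m + 1 - k = m + 1 by lia,
        show k + m + 1 + k + 2 = k + k + m + 2 + 1 by lia, poleParam]
      have h1 := hs m
      have h2 := hs (k + k + m + 2)
      have h3 := hs k
      have h4 := hs (k + m + 1)
      have h6 := pow_ne_zero (k + 1) hQ0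
      rw [show Q ^ (k + m + 1 + 1) = Q ^ (k + 1) * Q ^ (m + 1) by ring] at h4 ⊢
      simp only [hgdef, add_assoc, Nat.reduceAdd, add_zero] at *
      field_simp)
  set E : ℕ → ℂ := fun k => (-1) ^ (k + 1) * (∏ i ∈ range (k + 1), Q ^ i) * Q ^ (k + 1) *
        (1 + Q ^ (k + 1)) / (1 - Q ^ (k + 1)) ^ 2 with hEdef
  have hE : ∀ k, -(0 + poleParam Q k) *
      (∏ i ∈ range k, -Q ^ (i + 1)) * (g (k + 1) / g (2 * k + 2)) = E k := fun k => by
    have h1 := hs k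
    have h3 : 1 - (Q ^ (k + 1)) ^ 2 ≠ 0 := by
      have := hs (2 * k + 1)
      rwa [← pow_mul, show (k + 1) * 2 = 2 * k + 1 + 1 by lia]
    simp only [hgdef, poleParam, hEdef]
    rw [show Q ^ (2 * k + 2) = (Q ^ (k + 1)) ^ 2 by ring, prod_range_succ' _ k, prod_neg]
    simp only [card_range, pow_zero, mul_one]
    generalize Q ^ (k + 1) = v at *
    field_simp
    ring
  simp only [hE] at key
  have fin : ∀ N, (∏ k ∈ range N, (1 + poleParam Q k * t)⁻¹) *
      (1 + 2 * ∑ k ∈ range N, poleParam Q k * (t / (1 + poleParam Q k * t))) =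
      1 + ∑ k ∈ range N, E k * (t / (1 + poleParam Q k * t) - 2 * t / (1 + poleParam Q k * t) ^ 2)
        * centralRatio (fun n => ∏ i ∈ range n, g (i + 1)) N k := by
    intro N
    have hev : ∀ᶠ s in 𝓝 t, ∀ k < N, 1 + poleParam Q k * s ≠ 0 := by
      refine (Set.finite_lt_nat N).eventually_all.2 fun k _ => ?_
      have : ContinuousAt (fun s => 1 + poleParam Q k * s) t := by fun_prop
      exact this.eventually_ne (ht k)
    have d := (hasDerivAt_prod_inv_one_add ht N).unique
      ((hasDerivAt_one_add_sum_div ht N).congr_of_eventuallyEq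
        (hev.mono fun s hs => key N s hs))
    have k0 := key N t fun k _ => ht k
    simp only [zero_mul, sub_zero, one_div] at d k0
    have e1 : ∑ k ∈ range N, poleParam Q k * (t / (1 + poleParam Q k * t)) =
        t * ∑ k ∈ range N, poleParam Q k / (1 + poleParam Q k * t) := by
      rw [mul_sum]; exact sum_congr rfl fun k _ => by ring
    have e2 : ∑ k ∈ range N, E k * (t / (1 + poleParam Q k * t) -
        2 * t / (1 + poleParam Q k * t) ^ 2)
        * centralRatio (fun n => ∏ i ∈ range n, g (i + 1)) N k =
        ∑ k ∈ range N, E k * centralRatio (fun n => ∏ i ∈ range n, g (i + 1)) N k *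
          (t / (1 + poleParam Q k * t)) - 2 * t *
        ∑ k ∈ range N, E k * centralRatio (fun n => ∏ i ∈ range n, g (i + 1)) N k *
          ((1 + poleParam Q k * t) ^ 2)⁻¹ := by
      rw [mul_sum, ← sum_sub_distrib]; exact sum_congr rfl fun k _ => by ring
    rw [e1, e2]
    linear_combination k0 - 2 * t * d
  obtain ⟨M, hM⟩ := exists_norm_centralRatio_le hl hG
  have hEs : Summable E := by
    have : Summable fun k => poleParam Q k *
        ((-1) ^ (k + 1) * (∏ i ∈ range (k + 1), Q ^ i) * (1 + Q ^ (k + 1))) := by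
      refine summable_mul_of_bounded (M := 2) (summable_poleParam hQ) fun k => ?_
      have h1 : ‖∏ i ∈ range (k + 1), Q ^ i‖ ≤ 1 := by
        rw [norm_prod]
        refine prod_le_one (fun _ _ => norm_nonneg _) fun i _ => ?_
        rw [norm_pow]; exact pow_le_one₀ (norm_nonneg _) hQ.le
      have h2 : ‖1 + Q ^ (k + 1)‖ ≤ 2 := by
        refine (norm_add_le _ _).trans ?_
        have := (norm_pow_succ_lt_one hQ k).le
        rw [norm_one]; linarith
      rw [norm_mul, norm_mul, norm_pow, norm_neg, norm_one, one_pow, one_mul]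
      calc _ ≤ (1 : ℝ) * 2 := by gcongr
        _ = 2 := one_mul 2
    refine this.congr fun k => ?_
    simp only [hEdef, poleParam]; ring
  have hy0 := (summable_poleParam hQ).tendsto_atTop_zero
  have hsum : Summable fun k =>
      E k * (t / (1 + poleParam Q k * t) - 2 * t / (1 + poleParam Q k * t) ^ 2) := by
    obtain ⟨M, hM⟩ := exists_norm_inv_one_add_mul_le hy0 t
    have h1 := summable_mul_div_one_add hEs hy0 t
    refine (h1.sub ((summable_mul_of_bounded h1 hM).mul_left 2)).congr fun k => ?_
    rw [div_eq_mul_inv (2 * t), ← inv_pow]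
    ring
  have lim := (tendsto_sum_mul_of_bounded hsum
    (fun N k _ => hM N k) (tendsto_centralRatio hl hG)).const_add 1
  have lim2 := hP.mul (((summable_mul_div_one_add (summable_poleParam hQ) hy0
    t).hasSum.tendsto_sum_nat.const_mul 2).const_add 1)
  exact tendsto_nhds_unique lim2 (lim.congr fun N => (fin N).symm)

theorem poch_eq_mul {Q : ℂ} (hQ : ‖Q‖ < 1) (a : ℂ) : poch a Q = (1 - a) * poch (a * Q) Q := by
  refine tendsto_nhds_unique ((tendsto_poch hQ a).comp (tendsto_add_atTop_nat 1))
    (((tendsto_poch hQ (a * Q)).const_mul (1 - a)).congr fun N => ?_)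
  simp only [Function.comp_apply]
  rw [prod_range_succ', pow_zero, mul_one, mul_comm]
  congr 1
  exact prod_congr rfl fun k _ => by ring

theorem poch_split_two {Q : ℂ} (hQ : ‖Q‖ < 1) (a : ℂ) :
    poch a Q = poch a (Q ^ 2) * poch (a * Q) (Q ^ 2) := by
  have hQ2 := norm_pow_succ_lt_one hQ 1
  have h : Tendsto (fun N : ℕ => 2 * N) atTop atTop := tendsto_id.const_mul_atTop' (by norm_num)
  refine tendsto_nhds_unique ((tendsto_poch hQ a).comp h)
    (((tendsto_poch hQ2 a).mul (tendsto_poch hQ2 (a * Q))).congr fun N => ?_)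
  simp only [Function.comp_apply]
  induction N with
  | zero => simp
  | succ N ih =>
    rw [mul_add, mul_one, prod_range_succ _ (2 * N + 1), prod_range_succ _ (2 * N), ← ih,
      prod_range_succ, prod_range_succ]
    ring

theorem poch_split_three {Q : ℂ} (hQ : ‖Q‖ < 1) (a : ℂ) :
    poch a Q = poch a (Q ^ 3) * poch (a * Q) (Q ^ 3) * poch (a * Q ^ 2) (Q ^ 3) := by
  have hQ3 := norm_pow_succ_lt_one hQ 2
  have h : Tendsto (fun N : ℕ => 3 * N) atTop atTop := tendsto_id.const_mul_atTop' (by norm_num)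
  refine tendsto_nhds_unique ((tendsto_poch hQ a).comp h)
    ((((tendsto_poch hQ3 a).mul (tendsto_poch hQ3 (a * Q))).mul
      (tendsto_poch hQ3 (a * Q ^ 2))).congr fun N => ?_)
  simp only [Function.comp_apply]
  induction N with
  | zero => simp
  | succ N ih =>
    rw [mul_add, mul_one, prod_range_succ _ (3 * N + 2), prod_range_succ _ (3 * N + 1),
      prod_range_succ _ (3 * N), ← ih, prod_range_succ, prod_range_succ, prod_range_succ]
    ring

theorem poch_mul_poch_neg {Q : ℂ} (hQ : ‖Q‖ < 1) (a : ℂ) :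
    poch a Q * poch (-a) Q = poch (a ^ 2) (Q ^ 2) := by
  refine tendsto_nhds_unique ((tendsto_poch hQ a).mul (tendsto_poch hQ (-a)))
    ((tendsto_poch (norm_pow_succ_lt_one hQ 1) (a ^ 2)).congr fun N => ?_)
  rw [← prod_mul_distrib]
  exact prod_congr rfl fun k _ => by ring

theorem one_add_poleParam_mul {a : ℂ} (hQ : ‖Q‖ < 1) (ha : a ≠ 0) (k : ℕ) :
    1 + poleParam Q k * (-(1 - a) ^ 2 / a) =
      (1 - a * Q * Q ^ k) * (1 - a⁻¹ * Q * Q ^ k) / (1 - Q * Q ^ k) ^ 2 := by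
  have := one_sub_ne_zero_of_norm_lt (norm_pow_succ_lt_one hQ k)
  rw [poleParam]
  rw [pow_succ', mul_assoc a, mul_assoc a⁻¹] at *
  generalize Q * Q ^ k = v at *
  field_simp
  ring

theorem one_sub_div_mul {a : ℂ} (hQ : ‖Q‖ < 1) (ha : a ≠ 0) (k : ℕ) :
    1 - Q ^ (k + 1) / (1 + Q ^ (k + 1)) ^ 2 * (-(1 - a) ^ 2 / a) =
      (1 - -(a * Q) * Q ^ k) * (1 - -(a⁻¹ * Q) * Q ^ k) / (1 - -Q * Q ^ k) ^ 2 := by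
  have := one_add_ne_zero_of_norm_lt (norm_pow_succ_lt_one hQ k)
  simp only [neg_mul, sub_neg_eq_add]
  rw [pow_succ', mul_assoc a, mul_assoc a⁻¹] at *
  generalize Q * Q ^ k = v at *
  field_simp
  ring

theorem summable_lambert {r ε : ℂ} (hr : ‖r‖ < 1) (hε : ‖ε‖ ≤ 1) (c : ℕ) :
    Summable fun p : ℕ × ℕ => ε ^ p.1 * r ^ ((3 * p.1 + c + 1) * (p.2 + 1)) := by
  have hg := summable_geometric_of_lt_one (norm_nonneg _) hr
  refine Summable.of_norm_bounded (hg.mul_of_nonneg hg (fun _ => by positivity)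
    (fun _ => by positivity)) fun p => ?_
  rw [norm_mul, norm_pow, norm_pow, ← pow_add]
  calc _ ≤ 1 * ‖r‖ ^ (p.1 + p.2) := by
        gcongr ?_ * ?_
        · exact pow_le_one₀ (norm_nonneg _) hε
        · exact pow_le_pow_of_le_one (norm_nonneg _) hr.le (by nlinarith [p.1.zero_le, p.2.zero_le])
    _ = _ := one_mul _

theorem hasSum_lambert_row {r : ℂ} (hr : ‖r‖ < 1) (n : ℕ) (e : ℂ) :
    HasSum (fun m : ℕ => e * r ^ ((n + 1) * (m + 1))) (e * (r ^ (n + 1) / (1 - r ^ (n + 1)))) := by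
  have := ((hasSum_geometric_of_norm_lt_one (norm_pow_succ_lt_one hr n)).mul_left
    (r ^ (n + 1))).mul_left e
  have e' : (fun m : ℕ => e * r ^ ((n + 1) * (m + 1))) =
      fun m => e * (r ^ (n + 1) * (r ^ (n + 1)) ^ m) := by
    funext m; ring
  rw [e']
  exact this

theorem hasSum_lambert_column {r ε : ℂ} (hr : ‖r‖ < 1) (hε : ‖ε‖ ≤ 1) (c m : ℕ) :
    HasSum (fun k : ℕ => ε ^ k * r ^ ((3 * k + c + 1) * (m + 1)))
      ((r ^ (m + 1)) ^ (c + 1) / (1 - ε * (r ^ (m + 1)) ^ 3)) := by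
  have h : ‖ε * (r ^ (m + 1)) ^ 3‖ < 1 := by
    rw [norm_mul, norm_pow _ 3]
    exact mul_lt_one_of_nonneg_of_lt_one_right hε (by positivity)
      (pow_lt_one₀ (norm_nonneg _) (norm_pow_succ_lt_one hr m) (by norm_num))
  have := (hasSum_geometric_of_norm_lt_one h).mul_left ((r ^ (m + 1)) ^ (c + 1))
  have e' : (fun k : ℕ => ε ^ k * r ^ ((3 * k + c + 1) * (m + 1))) =
      fun k => (r ^ (m + 1)) ^ (c + 1) * (ε * (r ^ (m + 1)) ^ 3) ^ k := by
    funext k; rw [mul_pow]; ring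
  rw [e']
  exact this

theorem summable_lambert_row {r ε : ℂ} (hr : ‖r‖ < 1) (hε : ‖ε‖ ≤ 1) (c : ℕ) :
    Summable fun k : ℕ => ε ^ k * (r ^ (3 * k + c + 1) / (1 - r ^ (3 * k + c + 1))) :=
  (summable_lambert hr hε c).prod.congr fun k => (hasSum_lambert_row hr (3 * k + c) (ε ^ k)).tsum_eq

theorem summable_lambert_column {r ε : ℂ} (hr : ‖r‖ < 1) (hε : ‖ε‖ ≤ 1) (c : ℕ) :
    Summable fun m : ℕ => (r ^ (m + 1)) ^ (c + 1) / (1 - ε * (r ^ (m + 1)) ^ 3) :=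
  (summable_lambert hr hε c).prod_symm.prod.congr fun m =>
    (hasSum_lambert_column hr hε c m).tsum_eq

theorem tsum_lambert_comm {r ε : ℂ} (hr : ‖r‖ < 1) (hε : ‖ε‖ ≤ 1) (c : ℕ) :
    ∑' k : ℕ, ε ^ k * (r ^ (3 * k + c + 1) / (1 - r ^ (3 * k + c + 1))) =
      ∑' m : ℕ, (r ^ (m + 1)) ^ (c + 1) / (1 - ε * (r ^ (m + 1)) ^ 3) := by
  have := (summable_lambert hr hε c).tsum_comm (f := fun k m : ℕ =>
    ε ^ k * r ^ ((3 * k + c + 1) * (m + 1)))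
  rw [tsum_congr fun m => (hasSum_lambert_column hr hε c m).tsum_eq,
    tsum_congr fun k => (hasSum_lambert_row hr (3 * k + c) (ε ^ k)).tsum_eq] at this
  exact this.symm

theorem hasSum_lambert_column_sub {r ε : ℂ} (hr : ‖r‖ < 1) (hε : ‖ε‖ ≤ 1) :
    HasSum (fun m : ℕ => (r ^ (m + 1) - ε * (r ^ (m + 1)) ^ 2) / (1 - ε * (r ^ (m + 1)) ^ 3))
      (r / (1 - r) + ∑' k : ℕ, ε ^ (k + 1) * (r ^ (3 * k + 4) / (1 - r ^ (3 * k + 4)) -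
        r ^ (3 * k + 2) / (1 - r ^ (3 * k + 2)))) := by
  have h0 := (summable_lambert_column hr hε 0).hasSum
  have h1 := (summable_lambert_column hr hε 1).hasSum.mul_left ε
  rw [← tsum_lambert_comm hr hε] at h0 h1
  have r0 := summable_lambert_row hr hε 0
  have r1 := (summable_lambert_row hr hε 1).mul_left ε
  rw [r0.tsum_eq_zero_add] at h0
  rw [← tsum_mul_left] at h1
  have r0' := (summable_nat_add_iff 1).2 r0
  have h2 := h0.sub h1
  have e : ∀ m : ℕ, (r ^ (m + 1) - ε * (r ^ (m + 1)) ^ 2) / (1 - ε * (r ^ (m + 1)) ^ 3) =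
      (r ^ (m + 1)) ^ (0 + 1) / (1 - ε * (r ^ (m + 1)) ^ 3) -
        ε * ((r ^ (m + 1)) ^ (1 + 1) / (1 - ε * (r ^ (m + 1)) ^ 3)) := fun m => by ring
  refine (h2.summable.congr fun m => (e m).symm).hasSum_iff.2
    ((tsum_congr e).trans (h2.tsum_eq.trans ?_))
  rw [add_sub_assoc, ← r0'.tsum_sub r1]
  congr 1
  · simp
  · refine tsum_congr fun k => ?_
    rw [show 3 * (k + 1) + 0 + 1 = 3 * k + 4 by ring]
    ring

/-- The Lambert series `∑ n, ε ^ |n| * sgn n * r ^ (3 n + 1) / (1 - r ^ (3 n + 1))`, folded onto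
the naturals. -/
noncomputable def lambertThree (ε r : ℂ) : ℂ :=
  r / (1 - r) + ∑' k : ℕ, ε ^ (k + 1) * (r ^ (3 * k + 4) / (1 - r ^ (3 * k + 4)) -
    r ^ (3 * k + 2) / (1 - r ^ (3 * k + 2)))

variable {r : ℂ}

theorem norm_cube_lt_one (hr : ‖r‖ < 1) : ‖r ^ 3‖ < 1 := norm_pow_succ_lt_one hr 2

theorem one_sub_pow_mul_ne_zero (hr : ‖r‖ < 1) (n k : ℕ) : 1 - r ^ (n + 1) * (r ^ 3) ^ k ≠ 0 := by
  have := one_sub_ne_zero_of_norm_lt (norm_pow_succ_lt_one hr (n + 3 * k))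
  rwa [← pow_mul, ← pow_add, show n + 1 + 3 * k = n + 3 * k + 1 by ring]

theorem one_add_poleParam_cube (hr0 : r ≠ 0) (hr : ‖r‖ < 1) (k : ℕ) :
    1 + poleParam (r ^ 3) k * (-(1 - r) ^ 2 / r) =
      (1 - r ^ 4 * (r ^ 3) ^ k) * (1 - r ^ 2 * (r ^ 3) ^ k) / (1 - r ^ 3 * (r ^ 3) ^ k) ^ 2 := by
  rw [one_add_poleParam_mul (norm_cube_lt_one hr) hr0, show r * r ^ 3 = r ^ 4 by ring,
    show r⁻¹ * r ^ 3 = r ^ 2 by field_simp]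

theorem one_sub_div_mul_cube (hr0 : r ≠ 0) (hr : ‖r‖ < 1) (k : ℕ) :
    1 - (r ^ 3) ^ (k + 1) / (1 + (r ^ 3) ^ (k + 1)) ^ 2 * (-(1 - r) ^ 2 / r) =
      (1 - -r ^ 4 * (r ^ 3) ^ k) * (1 - -r ^ 2 * (r ^ 3) ^ k) /
        (1 - -r ^ 3 * (r ^ 3) ^ k) ^ 2 := by
  rw [one_sub_div_mul (norm_cube_lt_one hr) hr0, show r * r ^ 3 = r ^ 4 by ring,
    show r⁻¹ * r ^ 3 = r ^ 2 by field_simp]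

theorem one_add_poleParam_cube_ne_zero (hr0 : r ≠ 0) (hr : ‖r‖ < 1) (k : ℕ) :
    1 + poleParam (r ^ 3) k * (-(1 - r) ^ 2 / r) ≠ 0 := by
  rw [one_add_poleParam_cube hr0 hr]
  exact div_ne_zero (mul_ne_zero (one_sub_pow_mul_ne_zero hr 3 k) (one_sub_pow_mul_ne_zero hr 1 k))
    (pow_ne_zero 2 (one_sub_pow_mul_ne_zero hr 2 k))

theorem poleParam_cube_mul_div (hr0 : r ≠ 0) (hr : ‖r‖ < 1) (k : ℕ) :
    poleParam (r ^ 3) k *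
      (-(1 - r) ^ 2 / r / (1 + poleParam (r ^ 3) k * (-(1 - r) ^ 2 / r))) =
      (1 - r) / (1 + r) * (r ^ (3 * k + 4) / (1 - r ^ (3 * k + 4)) -
        r ^ (3 * k + 2) / (1 - r ^ (3 * k + 2))) := by
  have h1 := one_sub_pow_mul_ne_zero hr 3 k
  have h2 := one_sub_pow_mul_ne_zero hr 2 k
  have h3 := one_sub_pow_mul_ne_zero hr 1 k
  have h4 := one_add_ne_zero_of_norm_lt hr
  rw [one_add_poleParam_cube hr0 hr, poleParam, pow_succ',
    show r ^ (3 * k + 4) = r ^ 4 * (r ^ 3) ^ k by ring,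
    show r ^ (3 * k + 2) = r ^ 2 * (r ^ 3) ^ k by ring]
  simp only [Nat.reduceAdd] at *
  generalize (r ^ 3) ^ k = v at *
  field_simp
  ring

theorem one_add_div_mul_one_add (hr0 : r ≠ 0) (hr : ‖r‖ < 1) (ε : ℂ) :
    (1 + r) / (1 - r) * (1 + 2 * ∑' k, ε ^ (k + 1) * (poleParam (r ^ 3) k *
      (-(1 - r) ^ 2 / r / (1 + poleParam (r ^ 3) k * (-(1 - r) ^ 2 / r))))) =
      1 + 2 * lambertThree ε r := by
  have h1 := one_sub_ne_zero_of_norm_lt hr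
  have h2 := one_add_ne_zero_of_norm_lt hr
  rw [tsum_congr fun k => show _ = (1 - r) / (1 + r) * (ε ^ (k + 1) *
    (r ^ (3 * k + 4) / (1 - r ^ (3 * k + 4)) - r ^ (3 * k + 2) / (1 - r ^ (3 * k + 2)))) by
      rw [poleParam_cube_mul_div hr0 hr]; ring, tsum_mul_left, lambertThree]
  field_simp
  ring

theorem poch_quotient_eq_one_add_lambertThree (hr0 : r ≠ 0) (hr : ‖r‖ < 1) :
    poch (-r) (r ^ 3) * poch (-r ^ 2) (r ^ 3) * poch (r ^ 3) (r ^ 3) ^ 2 /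
      (poch (-r ^ 3) (r ^ 3) ^ 2 * poch r (r ^ 3) * poch (r ^ 2) (r ^ 3)) =
      1 + 2 * lambertThree (-1) r := by
  have hr3 := norm_cube_lt_one hr
  have hp : ∀ n, poch (r ^ (n + 1)) (r ^ 3) ≠ 0 := fun n =>
    poch_ne_zero_of_norm_lt hr3 (norm_pow_succ_lt_one hr n)
  have hm : ∀ n, poch (-r ^ (n + 1)) (r ^ 3) ≠ 0 := fun n =>
    poch_ne_zero_of_norm_lt hr3 (by rw [norm_neg]; exact norm_pow_succ_lt_one hr n)
  have lim := (((tendsto_poch hr3 (-r ^ 4)).mul (tendsto_poch hr3 (-r ^ 2))).div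
    ((tendsto_poch hr3 (-r ^ 3)).pow 2) (pow_ne_zero 2 (hm 2))).div
    ((((tendsto_poch hr3 (r ^ 4)).mul (tendsto_poch hr3 (r ^ 2))).div
    ((tendsto_poch hr3 (r ^ 3)).pow 2) (pow_ne_zero 2 (hp 2))))
    (div_ne_zero (mul_ne_zero (hp 3) (hp 1)) (pow_ne_zero 2 (hp 2)))
  have key := theta_quotient_eq_one_add_tsum (pow_ne_zero 3 hr0) hr3
    (one_add_poleParam_cube_ne_zero hr0 hr) (lim.congr fun N => by
      simp only [Pi.div_apply]
      rw [← prod_mul_distrib, ← prod_mul_distrib, ← prod_pow, ← prod_pow, ← prod_div_distrib,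
        ← prod_div_distrib, ← prod_div_distrib]
      exact prod_congr rfl fun k _ => by
        rw [one_sub_div_mul_cube hr0 hr, one_add_poleParam_cube hr0 hr])
  rw [tsum_congr fun k => show _ = 2 * ((-1) ^ (k + 1) * (poleParam (r ^ 3) k *
      (-(1 - r) ^ 2 / r / (1 + poleParam (r ^ 3) k * (-(1 - r) ^ 2 / r))))) by ring,
    tsum_mul_left] at key
  rw [← one_add_div_mul_one_add hr0 hr, ← key, poch_eq_mul hr3 (-r), poch_eq_mul hr3 r,
    show -r * r ^ 3 = -r ^ 4 by ring, show r * r ^ 3 = r ^ 4 by ring]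
  have h1 := one_sub_ne_zero_of_norm_lt hr
  have h2 := hp 3
  have h3 := hp 1
  have h4 := hp 2
  have h5 := hm 2
  simp only [Nat.reduceAdd] at *
  field_simp
  ring

theorem poch_cube_quotient_eq_one_add_tsum (hr0 : r ≠ 0) (hr : ‖r‖ < 1) :
    poch r r ^ 3 * poch (-r ^ 3) (r ^ 3) / (poch (-r) r ^ 3 * poch (r ^ 3) (r ^ 3)) =
      1 + 6 * ∑' m : ℕ, (-1) ^ (m + 1) *
        (r ^ (m + 1) / (1 + r ^ (m + 1) + (r ^ (m + 1)) ^ 2)) := by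
  have hr3 := norm_cube_lt_one hr
  have hs := fun n => one_sub_ne_zero_of_norm_lt (norm_pow_succ_lt_one hr n)
  have ha := fun n => one_add_ne_zero_of_norm_lt (norm_pow_succ_lt_one hr n)
  have hf : ∀ n : ℕ, (1 - r ^ (n + 1)) * (1 + r ^ (n + 1) + (r ^ (n + 1)) ^ 2) =
      1 - (r ^ (n + 1)) ^ 3 := fun n => by ring
  have hq : ∀ n : ℕ, 1 + r ^ (n + 1) + (r ^ (n + 1)) ^ 2 ≠ 0 := fun n => by
    refine right_ne_zero_of_mul (a := 1 - r ^ (n + 1)) ?_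
    rw [hf]
    exact one_sub_ne_zero_of_norm_lt (norm_cube_lt_one (norm_pow_succ_lt_one hr n))
  have ht : ∀ k, 1 + poleParam r k * 3 =
      (1 + r ^ (k + 1) + (r ^ (k + 1)) ^ 2) / (1 - r ^ (k + 1)) ^ 2 := fun k => by
    have := hs k
    rw [poleParam]
    field_simp
    ring
  have lim := (((tendsto_poch hr r).pow 3).mul (tendsto_poch hr3 (-r ^ 3))).div
    (((tendsto_poch hr (-r)).pow 3).mul (tendsto_poch hr3 (r ^ 3)))
    (mul_ne_zero (pow_ne_zero 3 (poch_ne_zero_of_norm_lt hr (by rwa [norm_neg])))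
      (poch_ne_zero_of_norm_lt hr3 hr3))
  have key := theta_quotient_eq_one_add_tsum (t := 3) hr0 hr
    (fun k => by rw [ht]; exact div_ne_zero (hq k) (pow_ne_zero 2 (hs k)))
    (lim.congr fun N => by
      simp only [Pi.div_apply]
      rw [← prod_pow, ← prod_pow, ← prod_mul_distrib, ← prod_mul_distrib, ← prod_div_distrib]
      refine prod_congr rfl fun k _ => ?_
      have h1 := hs k
      have h2 := ha k
      have h3 := hq k
      have h4 := hf k
      rw [ht, show r ^ 3 * (r ^ 3) ^ k = (r ^ (k + 1)) ^ 3 by ring,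
        show -r ^ 3 * (r ^ 3) ^ k = -(r ^ (k + 1)) ^ 3 by ring, ← h4, neg_mul, ← pow_succ',
        sub_neg_eq_add, sub_neg_eq_add]
      generalize r ^ (k + 1) = v at *
      field_simp
      ring)
  rw [key, ← tsum_mul_left]
  congr 1
  refine tsum_congr fun k => ?_
  rw [ht, poleParam]
  have h1 := hs k
  have h3 := hq k
  field_simp
  ring

theorem one_add_add_sq_ne_zero {v : ℂ} (hv : ‖v‖ < 1) : 1 + v + v ^ 2 ≠ 0 := by
  refine right_ne_zero_of_mul (a := 1 - v) ?_
  rw [show (1 - v) * (1 + v + v ^ 2) = 1 - v ^ 3 by ring]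
  exact one_sub_ne_zero_of_norm_lt (norm_cube_lt_one hv)

theorem hasSum_lambertThree_one (hr : ‖r‖ < 1) :
    HasSum (fun m : ℕ => r ^ (m + 1) / (1 + r ^ (m + 1) + (r ^ (m + 1)) ^ 2))
      (lambertThree 1 r) := by
  refine (hasSum_lambert_column_sub hr (ε := 1) (by simp)).congr_fun fun m => ?_
  have h1 := one_sub_ne_zero_of_norm_lt (norm_pow_succ_lt_one hr m)
  have h2 := one_add_add_sq_ne_zero (norm_pow_succ_lt_one hr m)
  rw [one_mul, one_mul, show 1 - (r ^ (m + 1)) ^ 3 =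
    (1 - r ^ (m + 1)) * (1 + r ^ (m + 1) + (r ^ (m + 1)) ^ 2) by ring]
  field_simp

theorem lambertThree_neg_one (hr : ‖r‖ < 1) :
    lambertThree (-1) r = lambertThree 1 r + 2 * lambertThree 1 (r ^ 2) := by
  have h := (hasSum_lambertThree_one hr).add
    ((hasSum_lambertThree_one (norm_pow_succ_lt_one hr 1)).mul_left 2)
  refine (hasSum_lambert_column_sub hr (ε := -1) (by simp)).unique (h.congr_fun fun m => ?_)
  have h1 := one_add_ne_zero_of_norm_lt (norm_pow_succ_lt_one hr m)
  have h2 := one_add_add_sq_ne_zero (norm_pow_succ_lt_one hr m)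
  have h3 : 1 - r ^ (m + 1) + (r ^ (m + 1)) ^ 2 ≠ 0 := by
    have := one_add_add_sq_ne_zero (v := -r ^ (m + 1))
      (by rw [norm_neg]; exact norm_pow_succ_lt_one hr m)
    rwa [neg_sq, ← sub_eq_add_neg] at this
  have e : ∀ v : ℂ, 1 + v ^ 2 + (v ^ 2) ^ 2 = (1 + v + v ^ 2) * (1 - v + v ^ 2) :=
    fun v => by ring
  have e' : ∀ v : ℂ, 1 - -1 * v ^ 3 = (1 + v) * (1 - v + v ^ 2) := fun v => by ring
  rw [show (r ^ (1 + 1)) ^ (m + 1) = (r ^ (m + 1)) ^ 2 by ring, e, e']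
  generalize r ^ (m + 1) = v at *
  field_simp
  ring

theorem tsum_neg_one_pow_mul_eq (hr : ‖r‖ < 1) :
    ∑' m : ℕ, (-1) ^ (m + 1) * (r ^ (m + 1) / (1 + r ^ (m + 1) + (r ^ (m + 1)) ^ 2)) =
      2 * lambertThree 1 (r ^ 2) - lambertThree 1 r := by
  have hs := hasSum_lambertThree_one hr
  set u : ℕ → ℂ := fun m => r ^ (m + 1) / (1 + r ^ (m + 1) + (r ^ (m + 1)) ^ 2) with hu
  have he : Summable fun k => u (2 * k) :=
    hs.summable.comp_injective (mul_right_injective₀ two_ne_zero)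
  have ho : HasSum (fun k => u (2 * k + 1)) (lambertThree 1 (r ^ 2)) :=
    (hasSum_lambertThree_one (norm_pow_succ_lt_one hr 1)).congr_fun fun k => by
      simp only [hu]
      rw [show r ^ (2 * k + 1 + 1) = (r ^ (1 + 1)) ^ (k + 1) by ring]
  have hsplit := (he.hasSum.even_add_odd ho).unique hs
  have halt : HasSum (fun m : ℕ => (-1) ^ (m + 1) * u m)
      (-(∑' k, u (2 * k)) + lambertThree 1 (r ^ 2)) :=
    HasSum.even_add_odd (he.hasSum.neg.congr_fun fun k => by rw [pow_succ, pow_mul]; simp)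
      (ho.congr_fun fun k => by rw [pow_succ, pow_succ, pow_mul]; simp)
  rw [halt.tsum_eq]
  linear_combination -hsplit

theorem three_mul_one_add_lambertThree (hr : ‖r‖ < 1) :
    3 * (1 + 2 * lambertThree (-1) r) + (1 + 6 * ∑' m : ℕ, (-1) ^ (m + 1) *
        (r ^ (m + 1) / (1 + r ^ (m + 1) + (r ^ (m + 1)) ^ 2))) =
      4 + 24 * lambertThree 1 (r ^ 2) := by
  rw [tsum_neg_one_pow_mul_eq hr, lambertThree_neg_one hr]
  ring

theorem poch_quotient_mul_one_add_lambertThree (hr0 : r ≠ 0) (hr : ‖r‖ < 1) :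
    poch (r ^ 3) (r ^ 3) ^ 2 / (poch r (r ^ 3) * poch (r ^ 2) (r ^ 3)) *
      (1 + 2 * lambertThree 1 r) = (1 + r) / (1 - r) ^ 2 *
      (1 + ∑' k, (-1) ^ (k + 1) * (∏ i ∈ range (k + 1), (r ^ 3) ^ i) * (r ^ 3) ^ (k + 1) *
        (1 + (r ^ 3) ^ (k + 1)) / (1 - (r ^ 3) ^ (k + 1)) ^ 2 *
          (-(1 - r) ^ 2 / r / (1 + poleParam (r ^ 3) k * (-(1 - r) ^ 2 / r)) -
            2 * (-(1 - r) ^ 2 / r) / (1 + poleParam (r ^ 3) k * (-(1 - r) ^ 2 / r)) ^ 2)) := by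
  have hr3 := norm_cube_lt_one hr
  have hp : ∀ n, poch (r ^ (n + 1)) (r ^ 3) ≠ 0 := fun n =>
    poch_ne_zero_of_norm_lt hr3 (norm_pow_succ_lt_one hr n)
  have lim := ((tendsto_poch hr3 (r ^ 3)).pow 2).div
    ((tendsto_poch hr3 (r ^ 4)).mul (tendsto_poch hr3 (r ^ 2))) (mul_ne_zero (hp 3) (hp 1))
  have key := mul_one_add_two_tsum_eq (pow_ne_zero 3 hr0) hr3
    (one_add_poleParam_cube_ne_zero hr0 hr) (lim.congr fun N => by
      simp only [Pi.div_apply]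
      rw [← prod_mul_distrib, ← prod_pow, ← prod_div_distrib]
      exact prod_congr rfl fun k _ => by rw [one_add_poleParam_cube hr0 hr, inv_div])
  have h1 := one_add_div_mul_one_add hr0 hr 1
  simp only [one_pow, one_mul] at h1
  rw [← key, ← h1, poch_eq_mul hr3 r, show r * r ^ 3 = r ^ 4 by ring]
  have h2 := one_sub_ne_zero_of_norm_lt hr
  have h3 := hp 3
  have h4 := hp 1
  simp only [Nat.reduceAdd] at *
  field_simp

theorem summable_neg_one_pow_mul_div {e : ℕ → ℕ} {d : ℕ → ℂ} (hr : ‖r‖ < 1) (he : ∀ k, k ≤ e k)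
    (hd : ∀ k, 1 - ‖r‖ ≤ ‖d k‖) : Summable fun k => (-1) ^ (k + 1) * r ^ e k / d k ^ 2 := by
  refine Summable.of_norm_bounded
    ((summable_geometric_of_lt_one (norm_nonneg _) hr).div_const ((1 - ‖r‖) ^ 2)) fun k => ?_
  rw [norm_div, norm_mul, norm_pow, norm_pow, norm_pow, norm_neg, norm_one, one_pow, one_mul]
  have : 0 < 1 - ‖r‖ := by linarith
  exact div_le_div₀ (by positivity) (pow_le_pow_of_le_one (norm_nonneg _) hr.le (he k))
    (by positivity) (pow_le_pow_left₀ this.le (hd k) 2)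

theorem tsum_int_eq {ε : ℂ} (hr0 : r ≠ 0) (hr : ‖r‖ < 1) (hε : ε ^ 2 = 1) :
    ∃ A B : ℂ,
      HasSum (fun k : ℕ => (-1) ^ (k + 1) * r ^ (3 * k ^ 2 + 9 * k + 6) /
        (1 + ε * r ^ (3 * k + 4)) ^ 2) A ∧
      HasSum (fun k : ℕ => (-1) ^ (k + 1) * r ^ (3 * k ^ 2 + 9 * k + 4) /
        (1 + ε * r ^ (3 * k + 2)) ^ 2) B ∧
      ∑' n : ℤ, (-1 : ℂ) ^ n * r ^ (3 * n ^ 2 + 3 * n) / (1 + ε * r ^ (3 * n + 1)) ^ 2 =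
        A + 1 / (1 + ε * r) ^ 2 + B := by
  have hε1 : ‖ε‖ = 1 := by
    have := congrArg norm hε
    rw [norm_pow, norm_one] at this
    exact (pow_eq_one_iff_of_nonneg (norm_nonneg _) two_ne_zero).1 this
  have hd : ∀ n, 1 - ‖r‖ ≤ ‖1 + ε * r ^ (n + 1)‖ := fun n => by
    have h1 : ‖ε * r ^ (n + 1)‖ ≤ ‖r‖ := by
      rw [norm_mul, hε1, one_mul, norm_pow]
      exact pow_le_of_le_one (norm_nonneg _) hr.le (by lia)
    have h2 := norm_sub_norm_le 1 (-(ε * r ^ (n + 1)))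
    rw [norm_neg, sub_neg_eq_add, norm_one] at h2
    linarith
  have sA := summable_neg_one_pow_mul_div (e := fun k => 3 * k ^ 2 + 9 * k + 6) hr
    (fun k => by nlinarith) (fun k => hd (3 * k + 3))
  have sB := summable_neg_one_pow_mul_div (e := fun k => 3 * k ^ 2 + 9 * k + 4) hr
    (fun k => by nlinarith) (fun k => hd (3 * k + 1))
  refine ⟨_, _, sA.hasSum, sB.hasSum, ?_⟩
  set f : ℤ → ℂ := fun n =>
    (-1 : ℂ) ^ n * r ^ (3 * n ^ 2 + 3 * n) / (1 + ε * r ^ (3 * n + 1)) ^ 2 with hf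
  have fA : ∀ k : ℕ, f (k + 1) = (-1) ^ (k + 1) * r ^ (3 * k ^ 2 + 9 * k + 6) /
      (1 + ε * r ^ (3 * k + 3 + 1)) ^ 2 := fun k => by
    simp only [hf]
    rw [← zpow_natCast (-1 : ℂ), ← zpow_natCast r, ← zpow_natCast r]
    push_cast
    ring_nf
  have fB : ∀ k : ℕ, f (-(k + 1)) = (-1) ^ (k + 1) * r ^ (3 * k ^ 2 + 9 * k + 4) /
      (1 + ε * r ^ (3 * k + 1 + 1)) ^ 2 := fun k => by
    simp only [hf]
    have h1 : r ^ (3 * (-((k : ℤ) + 1)) + 1) = (r ^ (3 * k + 1 + 1))⁻¹ := by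
      rw [← zpow_natCast r, ← zpow_neg]; push_cast; ring_nf
    have h2 : r ^ (3 * (-((k : ℤ) + 1)) ^ 2 + 3 * (-((k : ℤ) + 1))) = r ^ (3 * k ^ 2 + 3 * k) := by
      rw [← zpow_natCast r]; push_cast; ring_nf
    have h3 : (-1 : ℂ) ^ (-((k : ℤ) + 1)) = (-1) ^ (k + 1) := by
      rw [zpow_neg, ← inv_zpow, inv_neg_one, ← zpow_natCast]; push_cast; rfl
    rw [h1, h2, h3, show r ^ (3 * k ^ 2 + 9 * k + 4) =
      r ^ (3 * k ^ 2 + 3 * k) * (r ^ (3 * k + 1 + 1)) ^ 2 by ring]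
    have h4 : r ^ (3 * k + 1 + 1) ≠ 0 := pow_ne_zero _ hr0
    have h5 : 1 + ε * r ^ (3 * k + 1 + 1) ≠ 0 := fun h => by
      have := hd (3 * k + 1)
      rw [h, norm_zero] at this
      linarith
    have h6 : (1 + ε * (r ^ (3 * k + 1 + 1))⁻¹) ^ 2 * (r ^ (3 * k + 1 + 1)) ^ 2 =
        (1 + ε * r ^ (3 * k + 1 + 1)) ^ 2 := by
      generalize r ^ (3 * k + 1 + 1) = v at *
      field_simp
      linear_combination (1 - v ^ 2) * hε
    rw [← h6]
    have h7 : (1 + ε * (r ^ (3 * k + 1 + 1))⁻¹) ^ 2 ≠ 0 := fun h => by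
      rw [h, zero_mul] at h6
      exact pow_ne_zero 2 h5 h6.symm
    field_simp
  rw [tsum_of_add_one_of_neg_add_one (f := f) (sA.congr fun k => (fA k).symm)
    (sB.congr fun k => (fB k).symm), tsum_congr fA, tsum_congr fB]
  simp [hf]

theorem add_inv_sq_eq_mul_sub {q x : ℂ} (hq0 : q ≠ 0) (h1 : 1 + q ^ 2 * x ≠ 0)
    (h2 : 1 - q ^ 2 * x ≠ 0) (h3 : 1 + x ≠ 0) (h4 : 1 - x ≠ 0) (h5 : 1 - q ^ 2 * x ^ 2 ≠ 0)
    (h6 : 1 - q ^ 2 ≠ 0) {t D : ℂ} (ht : t = -(1 - q ^ 2) ^ 2 / q ^ 2)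
    (hD : D = (1 - q ^ 4 * x ^ 2) * (1 - x ^ 2) / (1 - q ^ 2 * x ^ 2) ^ 2) :
    q ^ 2 / (1 + q ^ 2 * x) ^ 2 + q ^ 2 / (1 - q ^ 2 * x) ^ 2 + 1 / (1 + x) ^ 2 +
      1 / (1 - x) ^ 2 = 2 * ((1 + q ^ 2) / (1 - q ^ 2) ^ 2) *
      (q ^ 2 * (1 + q ^ 2 * x ^ 2) / (1 - q ^ 2 * x ^ 2) ^ 2 * (t / D - 2 * t / D ^ 2)) := by
  have e : D = (1 - q ^ 2 * x) * (1 + q ^ 2 * x) * ((1 - x) * (1 + x)) /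
      (1 - q ^ 2 * x ^ 2) ^ 2 := by
    rw [hD]; ring
  rw [e, ht]
  field_simp
  ring

theorem tsum_add_tsum_eq {q : ℂ} (hq0 : q ≠ 0) (hq : ‖q‖ < 1) :
    (∑' n : ℤ, (-1 : ℂ) ^ n * q ^ (3 * n ^ 2 + 3 * n) / (1 + q ^ (3 * n + 1)) ^ 2)
      + (∑' n : ℤ, (-1 : ℂ) ^ n * q ^ (3 * n ^ 2 + 3 * n) / (1 - q ^ (3 * n + 1)) ^ 2) =
    2 * (poch ((q ^ 2) ^ 3) ((q ^ 2) ^ 3) ^ 2 /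
      (poch (q ^ 2) ((q ^ 2) ^ 3) * poch ((q ^ 2) ^ 2) ((q ^ 2) ^ 3)) *
      (1 + 2 * lambertThree 1 (q ^ 2))) := by
  have hr := norm_pow_succ_lt_one hq 1
  have hr0 := pow_ne_zero 2 hq0
  obtain ⟨A, B, hA, hB, h1⟩ := tsum_int_eq (ε := 1) hq0 hq (by norm_num)
  obtain ⟨A', B', hA', hB', h2⟩ := tsum_int_eq (ε := -1) hq0 hq (by norm_num)
  simp only [one_mul, neg_one_mul, ← sub_eq_add_neg] at hA hB h1 hA' hB' h2
  rw [h1, h2, poch_quotient_mul_one_add_lambertThree hr0 hr]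
  have hsum := (hA.add hA').add (hB.add hB')
  have hq1 := one_sub_ne_zero_of_norm_lt hq
  have hq2 := one_add_ne_zero_of_norm_lt hq
  have hq3 := one_sub_ne_zero_of_norm_lt hr
  have h0 : 1 / (1 + q) ^ 2 + 1 / (1 - q) ^ 2 = 2 * ((1 + q ^ 2) / (1 - q ^ 2) ^ 2) := by
    rw [show 1 - q ^ (1 + 1) = (1 - q) * (1 + q) by ring] at hq3
    rw [show 1 - q ^ 2 = (1 - q) * (1 + q) by ring]
    field_simp
    ring
  suffices hh : (A + A') + (B + B') = 2 * ((1 + q ^ 2) / (1 - q ^ 2) ^ 2) * _ by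
    rw [mul_add, mul_one, mul_add, ← mul_assoc, ← hh, ← h0]
    ring
  rw [← tsum_mul_left, ← hsum.tsum_eq]
  refine tsum_congr fun k => ?_
  have hx : q ^ (3 * k + 4) = q ^ 2 * q ^ (3 * k + 2) := by ring
  have key := add_inv_sq_eq_mul_sub (x := q ^ (3 * k + 2)) hq0
    (by rw [← hx]; exact one_add_ne_zero_of_norm_lt (norm_pow_succ_lt_one hq _))
    (by rw [← hx]; exact one_sub_ne_zero_of_norm_lt (norm_pow_succ_lt_one hq _))
    (one_add_ne_zero_of_norm_lt (norm_pow_succ_lt_one hq _))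
    (one_sub_ne_zero_of_norm_lt (norm_pow_succ_lt_one hq _))
    (by rw [show q ^ 2 * (q ^ (3 * k + 2)) ^ 2 = q ^ (6 * k + 5 + 1) by ring]
        exact one_sub_ne_zero_of_norm_lt (norm_pow_succ_lt_one hq _)) hq3 rfl
    (D := 1 + poleParam ((q ^ 2) ^ 3) k * (-(1 - q ^ 2) ^ 2 / q ^ 2)) (by
      rw [one_add_poleParam_cube hr0 hr]; ring)
  have hprod : ∏ i ∈ range (k + 1), ((q ^ 2) ^ 3) ^ i = q ^ (3 * k ^ 2 + 3 * k) := by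
    rw [prod_pow_eq_pow_sum, ← pow_mul, ← pow_mul]
    congr 1
    have := sum_range_id_mul_two (k + 1)
    rw [Nat.add_sub_cancel] at this
    linear_combination 3 * this
  rw [hprod, show ((q ^ 2) ^ 3) ^ (k + 1) = q ^ 2 * (q ^ (3 * k + 2)) ^ 2 by ring, hx,
    show q ^ (3 * k ^ 2 + 9 * k + 6) = q ^ (3 * k ^ 2 + 9 * k + 4) * q ^ 2 by ring]
  rw [show q ^ (3 * k ^ 2 + 9 * k + 4) = q ^ (3 * k ^ 2 + 3 * k) * (q ^ (3 * k + 2)) ^ 2 by ring]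
  linear_combination (-1) ^ (k + 1) * (q ^ (3 * k ^ 2 + 3 * k) * (q ^ (3 * k + 2)) ^ 2) * key

theorem poch_quotient_eq {q : ℂ} (hq : ‖q‖ < 1) :
    poch (-q) (q ^ 3) * poch (-q ^ 2) (q ^ 3) * poch (q ^ 3) (q ^ 3) ^ 2 /
      (poch (-q ^ 3) (q ^ 3) ^ 2 * poch q (q ^ 3) * poch (q ^ 2) (q ^ 3)) =
    poch (q ^ 3) (q ^ 6) ^ 4 * poch (q ^ 6) (q ^ 6) ^ 2 /
      (poch q (q ^ 6) ^ 2 * poch (q ^ 5) (q ^ 6) ^ 2 * poch (q ^ 2) (q ^ 6) *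
        poch (q ^ 4) (q ^ 6)) ∧
    poch q q ^ 3 * poch (-q ^ 3) (q ^ 3) / (poch (-q) q ^ 3 * poch (q ^ 3) (q ^ 3)) =
    poch q (q ^ 6) ^ 6 * poch (q ^ 5) (q ^ 6) ^ 6 * poch (q ^ 2) (q ^ 6) ^ 3 *
      poch (q ^ 4) (q ^ 6) ^ 3 * poch (q ^ 3) (q ^ 6) ^ 4 * poch (q ^ 6) (q ^ 6) ^ 2 := by
  have hq3 := norm_cube_lt_one hq
  have hq6 := norm_pow_succ_lt_one hq 5
  have a1 : poch q (q ^ 6) ≠ 0 := poch_ne_zero_of_norm_lt hq6 hq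
  have a : ∀ n, poch (q ^ (n + 1)) (q ^ 6) ≠ 0 := fun n =>
    poch_ne_zero_of_norm_lt hq6 (norm_pow_succ_lt_one hq n)
  have a2 := a 1
  have a3 := a 2
  have a4 := a 3
  have a5 := a 4
  have a6 := a 5
  have e6 : (q ^ 3) ^ 2 = q ^ 6 := by ring
  have s1 := poch_split_two hq3 q
  have s2 := poch_split_two hq3 (q ^ 2)
  have s3 := poch_split_two hq3 (q ^ 3)
  have m1 := poch_mul_poch_neg hq3 q
  have m2 := poch_mul_poch_neg hq3 (q ^ 2)
  have m3 := poch_mul_poch_neg hq3 (q ^ 3)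
  have t1 := poch_split_three hq q
  have n1 := poch_mul_poch_neg hq q
  have u1 := poch_split_three (norm_pow_succ_lt_one hq 1) (q ^ 2)
  rw [e6] at s1 s2 s3 m1 m2 m3
  rw [show q * q ^ 3 = q ^ 4 by ring] at s1
  rw [show q ^ 2 * q ^ 3 = q ^ 5 by ring] at s2
  rw [show q ^ 3 * q ^ 3 = q ^ 6 by ring] at s3
  rw [s1] at m1
  rw [s2, show (q ^ 2) ^ 2 = q ^ 4 by ring] at m2
  rw [s3] at m3
  rw [show q * q = q ^ 2 by ring, show q * q ^ 2 = q ^ 3 by ring, s1, s2, s3] at t1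
  rw [show q ^ (1 + 1) = q ^ 2 by ring, show q ^ 2 * q ^ 2 = q ^ 4 by ring,
    show q ^ 2 * (q ^ 2) ^ 2 = q ^ 6 by ring, show (q ^ 2) ^ 3 = q ^ 6 by ring] at u1
  rw [u1, t1] at n1
  simp only [Nat.reduceAdd] at a2 a3 a4 a5 a6
  replace m1 := eq_div_of_mul_eq (mul_ne_zero a1 a4) ((mul_comm _ _).trans m1)
  replace m2 := eq_div_of_mul_eq (mul_ne_zero a2 a5) ((mul_comm _ _).trans m2)
  replace m3 := eq_div_of_mul_eq (mul_ne_zero a3 a6) ((mul_comm _ _).trans m3)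
  replace n1 := eq_div_of_mul_eq (mul_ne_zero (mul_ne_zero (mul_ne_zero a1 a4)
    (mul_ne_zero a2 a5)) (mul_ne_zero a3 a6)) ((mul_comm _ _).trans n1)
  rw [m1, m2, m3, n1, t1, s1, s2, s3]
  constructor <;> field_simp

theorem Jm_two_eq {q : ℂ} (hq : ‖q‖ < 1) :
    Jm 2 q = poch (q ^ 2) (q ^ 6) * poch (q ^ 4) (q ^ 6) * poch (q ^ 6) (q ^ 6) := by
  rw [Jm, poch_split_three (norm_pow_succ_lt_one hq 1)]
  ring_nf

end

theorem stmt6 (q : ℂ) (hq0 : q ≠ 0) (hq : ‖q‖ < 1)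
    (h : ∀ n : ℤ, q ^ (3 * n + 1) ≠ 1 ∧ q ^ (3 * n + 1) ≠ -1) :
    (∑' n : ℤ, (-1 : ℂ) ^ n * q ^ (3 * n ^ 2 + 3 * n) / (1 + q ^ (3 * n + 1)) ^ 2)
      + (∑' n : ℤ, (-1 : ℂ) ^ n * q ^ (3 * n ^ 2 + 3 * n) / (1 - q ^ (3 * n + 1)) ^ 2)
      = 4 / 3 * (Jm 6 q) ^ 3 / Jm 2 q
        + (Jam 3 6 q) ^ 2 * (Jm 6 q) ^ 6 / (2 * (Jam 1 6 q) ^ 2 * (Jm 2 q) ^ 2)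
        + (Jam 1 6 q) ^ 6 * (Jm 2 q) ^ 2 * (Jam 3 6 q) ^ 2 / (6 * (Jm 6 q) ^ 6) := by
  have hq6 := norm_pow_succ_lt_one hq 5
  have a1 : poch q (q ^ 6) ≠ 0 := poch_ne_zero_of_norm_lt hq6 hq
  have a : ∀ n, poch (q ^ (n + 1)) (q ^ 6) ≠ 0 := fun n =>
    poch_ne_zero_of_norm_lt hq6 (norm_pow_succ_lt_one hq n)
  have a2 := a 1
  have a4 := a 3
  have a5 := a 4
  have a6 := a 5
  have rel := three_mul_one_add_lambertThree hq
  rw [← poch_quotient_eq_one_add_lambertThree hq0 hq, ← poch_cube_quotient_eq_one_add_tsum hq0 hq,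
    (poch_quotient_eq hq).1, (poch_quotient_eq hq).2] at rel
  have hL : 1 + 2 * lambertThree 1 (q ^ 2) = 2 / 3 + (4 + 24 * lambertThree 1 (q ^ 2)) / 12 := by
    ring
  rw [← rel] at hL
  rw [tsum_add_tsum_eq hq0 hq, hL, Jm_two_eq hq, ← pow_mul, ← pow_mul]
  simp only [Jm, Jam, Nat.reduceAdd, Nat.reduceMul, Nat.reduceSub, pow_one] at *
  field_simp
  ring
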